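/- Let A and B be countable right-orderable groups and G = A ∗ B. Let k ≥ 1 and let w = a₁b₁⋯a_k b_k ∈ G be a reduced word with aᵢ ∈ A∖{1} and bᵢ ∈ B∖{1}. For 1 ≤ i ≤ k set Iᵢ = (2(i−1), 2i) and Jᵢ = (2i−1, 2i+1), open intervals in ℝ, and let ε > 0. Then there exist group homomorphisms σ from A to the group of order-preserving bijections of ℝ and τ from B to the group of order-preserving bijections of ℝ (written as right actions) such that: for every α ∈ A, σ(α) maps each Iᵢ onto itself and fixes every point of ℝ outside ⋃ᵢ Iᵢ; for every β ∈ B, τ(β) maps each Jᵢ onto itself and fixes every point of ℝ outside ⋃ᵢ Jᵢ; and the homomorphism ν : G → order-preserving bijections of ℝ induced by σ and τ via the universal property of the free product satisfies 1·ν(w) ∈ (2k+1−ε, 2k+1), where 1 = inf J₁ and 2k+1 = sup J_k. -/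

import Mathlib

/-- A group is right-orderable if there is a strict total order on it invariant
under right multiplication. -/
def IsRightOrderable (H : Type*) [Group H] : Prop :=
  ∃ lt : H → H → Prop, IsStrictTotalOrder H lt ∧ ∀ f g h : H, lt f g → lt (f * h) (g * h)

/-- A right action of `G` on `ℝ` by orientation-preserving homeomorphisms, i.e. a map
to order-preserving bijections of `ℝ` satisfying `x·σ(gh) = (x·σ(g))·σ(h)`. -/
def IsRightAction {G : Type*} [Group G] (σ : G → (ℝ ≃o ℝ)) : Prop :=
  ∀ g h : G, σ (g * h) = (σ g).trans (σ h)

/-- The list of letters `a₁, b₁, …, a_k, b_k` of the word `w = a₁b₁⋯a_k b_k` in `A ∗ B`. -/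
def wordLetters {A B : Type*} [Group A] [Group B] {k : ℕ}
    (a : Fin k → A) (b : Fin k → B) : List (Monoid.Coprod A B) :=
  (List.finRange k).flatMap fun i => [Monoid.Coprod.inl (a i), Monoid.Coprod.inr (b i)]

/-- The interval `Iᵢ₊₁ = (2i, 2i + 2)` of the catenation `(I₁, J₁, …, I_k, J_k)`. -/
noncomputable def catI (i : ℕ) : Set ℝ := Set.Ioo (2 * (i : ℝ)) (2 * (i : ℝ) + 2)

/-- The interval `Jᵢ₊₁ = (2i + 1, 2i + 3)` of the catenation `(I₁, J₁, …, I_k, J_k)`. -/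
noncomputable def catJ (i : ℕ) : Set ℝ := Set.Ioo (2 * (i : ℝ) + 1) (2 * (i : ℝ) + 3)

/-- A family of monotone self-maps of `ℝ` obeying the laws of a right action consists of order
isomorphisms. -/
theorem exists_isRightAction_of_monotone {G : Type*} [Group G] (F : G → ℝ → ℝ)
    (mono : ∀ g, Monotone (F g)) (one : ∀ x, F 1 x = x)
    (mul : ∀ g h x, F (g * h) x = F h (F g x)) :
    ∃ σ : G → (ℝ ≃o ℝ), IsRightAction σ ∧ ∀ g x, σ g x = F g x := by
  refine ⟨fun g => Equiv.toOrderIso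
    ⟨F g, F g⁻¹, fun x => by rw [← mul, mul_inv_cancel, one],
      fun x => by rw [← mul, inv_mul_cancel, one]⟩ (mono g) (mono g⁻¹), ?_, fun g x => rfl⟩
  intro g h
  ext x
  exact mul g h x

theorem IsRightAction.one_apply {G : Type*} [Group G] {σ : G → (ℝ ≃o ℝ)}
    (hσ : IsRightAction σ) (x : ℝ) : σ 1 x = x := by
  have h := DFunLike.congr_fun (hσ 1 1) x
  rw [mul_one, OrderIso.trans_apply] at h
  exact ((σ 1).injective h).symm

theorem IsRightAction.mul_apply {G : Type*} [Group G] {σ : G → (ℝ ≃o ℝ)}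
    (hσ : IsRightAction σ) (g h : G) (x : ℝ) : σ (g * h) x = σ h (σ g x) :=
  DFunLike.congr_fun (hσ g h) x

/-- The extension of an automorphism of `(ℚ, <)` to `ℝ`. -/
noncomputable def realExtend (f : ℚ ≃o ℚ) (x : ℝ) : ℝ :=
  sSup ((fun q : ℚ => (f q : ℝ)) '' {q : ℚ | (q : ℝ) < x})

theorem ratCast_lt_realExtend_iff (f : ℚ ≃o ℚ) (x : ℝ) (q : ℚ) :
    (q : ℝ) < realExtend f x ↔ (f.symm q : ℝ) < x := by
  have hne : ((fun q : ℚ => (f q : ℝ)) '' {q : ℚ | (q : ℝ) < x}).Nonempty :=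
    Set.Nonempty.image _ (exists_rat_lt x)
  have hbdd : BddAbove ((fun q : ℚ => (f q : ℝ)) '' {q : ℚ | (q : ℝ) < x}) := by
    obtain ⟨s, hs⟩ := exists_rat_gt x
    refine ⟨f s, ?_⟩
    rintro _ ⟨r, hr, rfl⟩
    have hrs : r < s := by exact_mod_cast lt_trans hr hs
    exact Rat.cast_le.2 (f.monotone hrs.le)
  constructor
  · intro h
    obtain ⟨_, ⟨r, hr, rfl⟩, hqr⟩ := exists_lt_of_lt_csSup hne h
    have hqr' : f.symm q < r := by
      rw [OrderIso.symm_apply_lt]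
      exact Rat.cast_lt.1 hqr
    exact lt_trans (Rat.cast_lt.2 hqr') hr
  · intro h
    obtain ⟨r, hqr, hrx⟩ := exists_rat_btwn h
    have hqr' : q < f r := by
      rw [← OrderIso.symm_apply_lt]
      exact_mod_cast hqr
    exact lt_of_lt_of_le (Rat.cast_lt.2 hqr') (le_csSup hbdd ⟨r, hrx, rfl⟩)

theorem Real.eq_of_forall_ratCast_lt_iff {x y : ℝ} (h : ∀ q : ℚ, (q : ℝ) < x ↔ (q : ℝ) < y) :
    x = y :=
  le_antisymm (le_of_forall_rat_lt_imp_le fun q hq => ((h q).1 hq).le)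
    (le_of_forall_rat_lt_imp_le fun q hq => ((h q).2 hq).le)

theorem realExtend_mono (f : ℚ ≃o ℚ) : Monotone (realExtend f) := by
  refine fun x y hxy => le_of_forall_rat_lt_imp_le fun q hq => le_of_lt ?_
  rw [ratCast_lt_realExtend_iff] at hq ⊢
  exact hq.trans_le hxy

theorem realExtend_ratCast (f : ℚ ≃o ℚ) (q : ℚ) : realExtend f q = f q := by
  refine Real.eq_of_forall_ratCast_lt_iff fun r => ?_
  rw [ratCast_lt_realExtend_iff]
  norm_cast
  exact f.symm_apply_lt

theorem realExtend_refl (x : ℝ) : realExtend (OrderIso.refl ℚ) x = x :=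
  Real.eq_of_forall_ratCast_lt_iff fun q => ratCast_lt_realExtend_iff _ x q

theorem realExtend_trans (f g : ℚ ≃o ℚ) (x : ℝ) :
    realExtend (f.trans g) x = realExtend g (realExtend f x) := by
  refine Real.eq_of_forall_ratCast_lt_iff fun q => ?_
  simp only [ratCast_lt_realExtend_iff]
  rfl

/-- A nontrivial element of a right-orderable group is positive for some right order. -/
theorem IsRightOrderable.exists_one_lt {G : Type*} [Group G] (hG : IsRightOrderable G) {g : G}
    (hg : g ≠ 1) :
    ∃ lt : G → G → Prop, IsStrictTotalOrder G lt ∧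
      (∀ f g h : G, lt f g → lt (f * h) (g * h)) ∧ lt 1 g := by
  obtain ⟨lt, hlt, hmul⟩ := hG
  rcases trichotomous_of lt 1 g with h | h | h
  · exact ⟨lt, hlt, hmul, h⟩
  · exact absurd h.symm hg
  · exact ⟨Function.swap lt, inferInstance, fun f g h => hmul g f h, h⟩

/-- The dynamical realization of a countable right-orderable group, with a prescribed nontrivial
element moving some point to the right. -/
theorem IsRightOrderable.exists_isRightAction {G : Type*} [Group G] [Countable G]
    (hG : IsRightOrderable G) {g : G} (hg : g ≠ 1) :
    ∃ σ : G → (ℝ ≃o ℝ), IsRightAction σ ∧ ∃ u, u < σ g u := by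
  classical
  obtain ⟨lt, hlt, hmul, hlt_g⟩ := hG.exists_one_lt hg
  let _ : LinearOrder G := linearOrderOfSTO lt
  have hmono : ∀ h : G, StrictMono (· * h) := fun h x y hxy => hmul x y h hxy
  have hone : 1 < g := hlt_g
  have : Countable (G ×ₗ ℚ) := inferInstanceAs (Countable (G × ℚ))
  obtain ⟨e⟩ := Order.iso_of_countable_dense (G ×ₗ ℚ) ℚ
  let m : G → (G ×ₗ ℚ) ≃o (G ×ₗ ℚ) := fun h =>
    Prod.Lex.prodLexCongr ((hmono h).orderIsoOfSurjective _ (mul_right_surjective h))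
      (OrderIso.refl ℚ)
  have m_apply : ∀ h x, m h x = toLex ((ofLex x).1 * h, (ofLex x).2) := fun h x => rfl
  let f : G → (ℚ ≃o ℚ) := fun h => (e.symm.trans (m h)).trans e
  have f_apply : ∀ h x, f h x = e (m h (e.symm x)) := fun h x => rfl
  have f_one : f 1 = OrderIso.refl ℚ := by
    ext x
    simp [f_apply, m_apply]
  have f_mul : ∀ x y, f (x * y) = (f x).trans (f y) := by
    intro x y
    ext z
    simp [f_apply, m_apply, mul_assoc]
  obtain ⟨σ, hσ, hσ_apply⟩ := exists_isRightAction_of_monotone (fun h => realExtend (f h))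
    (fun h => realExtend_mono _) (fun x => by rw [f_one, realExtend_refl])
    (fun x y z => by rw [f_mul, realExtend_trans])
  refine ⟨σ, hσ, (e (toLex (1, 0)) : ℚ), ?_⟩
  rw [hσ_apply, realExtend_ratCast, Rat.cast_lt, f_apply, OrderIso.symm_apply_apply, m_apply,
    e.lt_iff_lt]
  simp [Prod.Lex.toLex_lt_toLex, hone]

/-- Any two points of an open interval, in increasing order, are matched by an order isomorphism
onto `ℝ` with any two reals, in increasing order. -/
theorem exists_orderIso_Ioo_apply_eq {c d p q u v : ℝ} (hp : p ∈ Set.Ioo c d)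
    (hq : q ∈ Set.Ioo c d) (hpq : p < q) (huv : u < v) :
    ∃ φ : Set.Ioo c d ≃o ℝ, φ ⟨p, hp⟩ = u ∧ φ ⟨q, hq⟩ = v := by
  have hcd : c < d := hp.1.trans hp.2
  let r : ℝ := (d - c) / 2
  have hr : 0 < r := by simp only [r]; linarith
  let e₁ : ℝ ≃o ℝ := (OrderIso.addRight (-((c + d) / 2))).trans (OrderIso.divRight₀ r hr)
  have hmem : ∀ x, x ∈ Set.Ioo c d ↔ e₁ x ∈ Set.Ioo (-1 : ℝ) 1 := by
    intro x
    have hx : e₁ x = (x + -((c + d) / 2)) / r := rfl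
    rw [hx, Set.mem_Ioo, Set.mem_Ioo, lt_div_iff₀ hr, div_lt_iff₀ hr]
    constructor <;> rintro ⟨h₁, h₂⟩ <;> simp only [r] at * <;> constructor <;> linarith
  let ψ : Set.Ioo c d ≃o ℝ :=
    OrderIso.trans ⟨e₁.toEquiv.subtypeEquiv hmem, e₁.le_iff_le⟩ (orderIsoIooNegOneOne ℝ).symm
  have hψ : ψ ⟨p, hp⟩ < ψ ⟨q, hq⟩ := ψ.strictMono hpq
  have hm : 0 < (v - u) / (ψ ⟨q, hq⟩ - ψ ⟨p, hp⟩) := div_pos (sub_pos.2 huv) (sub_pos.2 hψ)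
  let e₂ : ℝ ≃o ℝ := ((OrderIso.addRight (-ψ ⟨p, hp⟩)).trans
    (OrderIso.mulRight₀ _ hm)).trans (OrderIso.addRight u)
  have he₂ : ∀ x, e₂ x = (x + -ψ ⟨p, hp⟩) * ((v - u) / (ψ ⟨q, hq⟩ - ψ ⟨p, hp⟩)) + u :=
    fun x => rfl
  refine ⟨ψ.trans e₂, ?_, ?_⟩
  · rw [OrderIso.trans_apply, he₂]
    ring
  · have hne : ψ ⟨q, hq⟩ - ψ ⟨p, hp⟩ ≠ 0 := (sub_pos.2 hψ).ne'
    rw [OrderIso.trans_apply, he₂, ← sub_eq_add_neg, mul_div_cancel₀ _ hne]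
    ring

/-- The dynamical realization on an open interval, sending one prescribed point to another. -/
theorem IsRightOrderable.exists_isRightAction_Ioo {G : Type*} [Group G] [Countable G]
    (hG : IsRightOrderable G) {g : G} (hg : g ≠ 1) {c d p q : ℝ} (hp : p ∈ Set.Ioo c d)
    (hq : q ∈ Set.Ioo c d) (hpq : p < q) :
    ∃ σ : G → (ℝ ≃o ℝ), IsRightAction σ ∧ (∀ h, ∀ x ∉ Set.Ioo c d, σ h x = x) ∧ σ g p = q := by
  classical
  obtain ⟨ρ, hρ, u, hu⟩ := hG.exists_isRightAction hg
  obtain ⟨φ, hφp, hφq⟩ := exists_orderIso_Ioo_apply_eq hp hq hpq hu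
  let F : G → ℝ → ℝ := fun h x =>
    if hx : x ∈ Set.Ioo c d then (φ.symm (ρ h (φ ⟨x, hx⟩)) : ℝ) else x
  have F_mem : ∀ h x (hx : x ∈ Set.Ioo c d), F h x = φ.symm (ρ h (φ ⟨x, hx⟩)) :=
    fun h x hx => dif_pos hx
  have F_not_mem : ∀ h x, x ∉ Set.Ioo c d → F h x = x := fun h x hx => dif_neg hx
  have F_mem_Ioo : ∀ h x, x ∈ Set.Ioo c d → F h x ∈ Set.Ioo c d := fun h x hx => by
    rw [F_mem h x hx]
    exact Subtype.prop _
  have mono : ∀ h, Monotone (F h) := by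
    intro h x y hxy
    by_cases hx : x ∈ Set.Ioo c d <;> by_cases hy : y ∈ Set.Ioo c d
    · rw [F_mem h x hx, F_mem h y hy]
      exact φ.symm.monotone ((ρ h).monotone (φ.monotone hxy))
    · rw [F_not_mem h y hy]
      have hF := F_mem_Ioo h x hx
      by_contra! hlt
      exact hy ⟨hx.1.trans_le hxy, hlt.trans hF.2⟩
    · rw [F_not_mem h x hx]
      have hF := F_mem_Ioo h y hy
      by_contra! hlt
      exact hx ⟨hF.1.trans hlt, hxy.trans_lt hy.2⟩
    · rwa [F_not_mem h x hx, F_not_mem h y hy]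
  have one : ∀ x, F 1 x = x := by
    intro x
    by_cases hx : x ∈ Set.Ioo c d
    · simp [F_mem 1 x hx, hρ.one_apply]
    · exact F_not_mem 1 x hx
  have mul : ∀ h h' x, F (h * h') x = F h' (F h x) := by
    intro h h' x
    by_cases hx : x ∈ Set.Ioo c d
    · rw [F_mem h' _ (F_mem_Ioo h x hx), F_mem _ x hx]
      simp [F_mem h x hx, hρ.mul_apply]
    · rw [F_not_mem _ x hx, F_not_mem h x hx, F_not_mem h' x hx]
  obtain ⟨σ, hσ, hσ_apply⟩ := exists_isRightAction_of_monotone F mono one mul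
  refine ⟨σ, hσ, fun h x hx => by rw [hσ_apply, F_not_mem h x hx], ?_⟩
  rw [hσ_apply, F_mem g p hp, hφp, ← hφq, OrderIso.symm_apply_apply]

/-- Right actions supported on the intervals `(2n + o, 2n + o + 2)`, `n : ℤ`, glue to one. -/
theorem exists_isRightAction_glue {G : Type*} [Group G] (o : ℝ) (ρ : ℤ → G → (ℝ ≃o ℝ))
    (hρ : ∀ n, IsRightAction (ρ n))
    (hfix : ∀ (n : ℤ) (h : G), ∀ x ∉ Set.Ioo (2 * (n : ℝ) + o) (2 * n + o + 2), ρ n h x = x) :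
    ∃ σ : G → (ℝ ≃o ℝ), IsRightAction σ ∧
      ∀ (n : ℤ) (h : G), ∀ x ∈ Set.Ico (2 * (n : ℝ) + o) (2 * n + o + 2), σ h x = ρ n h x := by
  let N : ℝ → ℤ := fun x => ⌊(x - o) / 2⌋
  have N_eq_iff : ∀ (x : ℝ) (n : ℤ), N x = n ↔ x ∈ Set.Ico (2 * (n : ℝ) + o) (2 * n + o + 2) := by
    intro x n
    rw [Int.floor_eq_iff, Set.mem_Ico]
    constructor <;> rintro ⟨h₁, h₂⟩ <;> constructor <;> linarith
  have apply_mem : ∀ (n : ℤ) (h : G) (x : ℝ), x ∈ Set.Ico (2 * (n : ℝ) + o) (2 * n + o + 2) →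
      ρ n h x ∈ Set.Ico (2 * (n : ℝ) + o) (2 * n + o + 2) := by
    intro n h x hx
    have h₁ := hfix n h (2 * (n : ℝ) + o) (by simp)
    have h₂ := hfix n h (2 * (n : ℝ) + o + 2) (by simp)
    exact ⟨h₁ ▸ (ρ n h).monotone hx.1, lt_of_lt_of_eq ((ρ n h).strictMono hx.2) h₂⟩
  have N_apply : ∀ h x, N (ρ (N x) h x) = N x := fun h x =>
    (N_eq_iff _ _).2 (apply_mem _ h x ((N_eq_iff _ _).1 rfl))
  have mono : ∀ h, Monotone fun x => ρ (N x) h x := by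
    intro h x y hxy
    have hN : N x ≤ N y := Int.floor_mono (by linarith)
    rcases hN.eq_or_lt with heq | hlt
    · simp only [heq]
      exact (ρ (N y) h).monotone hxy
    · have hx := (apply_mem _ h x ((N_eq_iff _ _).1 rfl)).2
      have hy := (apply_mem _ h y ((N_eq_iff _ _).1 rfl)).1
      have hle : (N x : ℝ) + 1 ≤ N y := by exact_mod_cast hlt
      dsimp only
      linarith
  have one : ∀ x, ρ (N x) 1 x = x := fun x => (hρ _).one_apply x
  have mul : ∀ h h' x, ρ (N x) (h * h') x = ρ (N (ρ (N x) h x)) h' (ρ (N x) h x) := by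
    intro h h' x
    simp only [N_apply, (hρ _).mul_apply]
  obtain ⟨σ, hσ, hσ_apply⟩ := exists_isRightAction_of_monotone (fun h x => ρ (N x) h x)
    mono one mul
  refine ⟨σ, hσ, fun n h x hx => ?_⟩
  rw [hσ_apply, (N_eq_iff x n).2 hx]

/-- A right action supported on the intervals `(2i + o, 2i + o + 2)`, `i < k`, with one prescribed
move to the right inside each of them. -/
theorem IsRightOrderable.exists_isRightAction_chain {G : Type*} [Group G] [Countable G]
    (hG : IsRightOrderable G) {k : ℕ} (g : Fin k → G) (hg : ∀ i, g i ≠ 1) (o : ℝ)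
    (s t : ℕ → ℝ) (hst : ∀ i < k, s i < t i)
    (hs : ∀ i < k, s i ∈ Set.Ioo (2 * (i : ℝ) + o) (2 * i + o + 2))
    (ht : ∀ i < k, t i ∈ Set.Ioo (2 * (i : ℝ) + o) (2 * i + o + 2)) :
    ∃ σ : G → (ℝ ≃o ℝ), IsRightAction σ ∧
      (∀ h, ∀ i : Fin k, σ h '' Set.Ioo (2 * (i : ℝ) + o) (2 * i + o + 2) =
        Set.Ioo (2 * (i : ℝ) + o) (2 * i + o + 2)) ∧
      (∀ h, ∀ x ∉ ⋃ i : Fin k, Set.Ioo (2 * (i : ℝ) + o) (2 * i + o + 2), σ h x = x) ∧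
      ∀ i : Fin k, σ (g i) (s i) = t i := by
  have key : ∀ n : ℤ, ∃ ρ : G → (ℝ ≃o ℝ), IsRightAction ρ ∧
      (∀ h, ∀ x ∉ Set.Ioo (2 * (n : ℝ) + o) (2 * n + o + 2), ρ h x = x) ∧
      ((¬ ∃ i : Fin k, (i : ℤ) = n) → ∀ h x, ρ h x = x) ∧
      ∀ i : Fin k, (i : ℤ) = n → ρ (g i) (s i) = t i := by
    intro n
    by_cases hn : ∃ i : Fin k, (i : ℤ) = n
    · obtain ⟨i, rfl⟩ := hn
      obtain ⟨ρ, hρ, hfix, happ⟩ := hG.exists_isRightAction_Ioo (hg i) (hs i i.2) (ht i i.2)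
        (hst i i.2)
      refine ⟨ρ, hρ, by simpa using hfix, fun h => absurd ⟨i, rfl⟩ h, fun j hj => ?_⟩
      obtain rfl : j = i := Fin.ext (by exact_mod_cast hj)
      exact happ
    · exact ⟨fun _ => OrderIso.refl ℝ, fun _ _ => rfl, fun _ _ _ => rfl, fun _ _ _ => rfl,
        fun i hi => absurd ⟨i, hi⟩ hn⟩
  choose ρ hρ hfix htriv happ using key
  obtain ⟨σ, hσ, hσ_apply⟩ := exists_isRightAction_glue o ρ hρ hfix
  have hleft : ∀ (n : ℤ) h, σ h (2 * (n : ℝ) + o) = 2 * n + o := fun n h => by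
    rw [hσ_apply n h _ (by simp), hfix n h _ (by simp)]
  refine ⟨σ, hσ, fun h i => ?_, fun h x hx => ?_, fun i => ?_⟩
  · have h₁ := hleft i h
    have h₂ := hleft (i + 1) h
    push_cast at h₁ h₂
    rw [OrderIso.image_Ioo, h₁, show 2 * (i : ℝ) + o + 2 = 2 * (i + 1) + o by ring, h₂]
  · have hmem : x ∈ Set.Ico (2 * (⌊(x - o) / 2⌋ : ℝ) + o) (2 * ⌊(x - o) / 2⌋ + o + 2) := by
      have h₁ := Int.floor_le ((x - o) / 2)
      have h₂ := Int.lt_floor_add_one ((x - o) / 2)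
      constructor <;> linarith
    rw [hσ_apply _ h x hmem]
    by_cases hn : ∃ i : Fin k, (i : ℤ) = ⌊(x - o) / 2⌋
    · refine hfix _ h x fun hx' => hx ?_
      obtain ⟨i, hi⟩ := hn
      rw [← hi] at hx'
      exact Set.mem_iUnion.2 ⟨i, by simpa using hx'⟩
    · exact htriv _ hn h x
  · rw [hσ_apply i _ _ (by simpa using Set.Ioo_subset_Ico_self (hs i i.2)), happ i i rfl]

/-- Two right actions on `ℝ` induce one of the free product. -/
theorem exists_isRightAction_coprod {A B : Type*} [Group A] [Group B] {σ : A → (ℝ ≃o ℝ)}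
    {τ : B → (ℝ ≃o ℝ)} (hσ : IsRightAction σ) (hτ : IsRightAction τ) :
    ∃ ν : Monoid.Coprod A B → (ℝ ≃o ℝ), IsRightAction ν ∧
      (∀ α, ν (Monoid.Coprod.inl α) = σ α) ∧ ∀ β, ν (Monoid.Coprod.inr β) = τ β := by
  let σ' : A →* (ℝ ≃o ℝ)ᵐᵒᵖ := MonoidHom.mk' (fun g => MulOpposite.op (σ g)) fun g h => by
    rw [hσ g h]
    rfl
  let τ' : B →* (ℝ ≃o ℝ)ᵐᵒᵖ := MonoidHom.mk' (fun g => MulOpposite.op (τ g)) fun g h => by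
    rw [hτ g h]
    rfl
  refine ⟨fun x => (Monoid.Coprod.lift σ' τ' x).unop, fun g h => ?_, fun α => ?_, fun β => ?_⟩
  · dsimp only
    rw [map_mul]
    rfl
  · dsimp only
    rw [Monoid.Coprod.lift_apply_inl]
    rfl
  · dsimp only
    rw [Monoid.Coprod.lift_apply_inr]
    rfl

theorem wordLetters_succ {A B : Type*} [Group A] [Group B] {k : ℕ} (a : Fin (k + 1) → A)
    (b : Fin (k + 1) → B) :
    wordLetters a b = wordLetters (a ∘ Fin.castSucc) (b ∘ Fin.castSucc) ++
      [Monoid.Coprod.inl (a (Fin.last k)), Monoid.Coprod.inr (b (Fin.last k))] := by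
  simp [wordLetters, List.finRange_succ_last, List.flatMap_map]

theorem IsRightAction.wordLetters_prod_apply {A B : Type*} [Group A] [Group B]
    {ν : Monoid.Coprod A B → (ℝ ≃o ℝ)} (hν : IsRightAction ν) (s t : ℕ → ℝ) {k : ℕ}
    (a : Fin k → A) (b : Fin k → B)
    (ha : ∀ i : Fin k, ν (Monoid.Coprod.inl (a i)) (s i) = t i)
    (hb : ∀ i : Fin k, ν (Monoid.Coprod.inr (b i)) (t i) = s (i + 1)) :
    ν (wordLetters a b).prod (s 0) = s k := by
  induction k with
  | zero => simpa [wordLetters] using hν.one_apply (s 0)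
  | succ k ih =>
    have h := ih (a ∘ Fin.castSucc) (b ∘ Fin.castSucc) (fun i => ha i.castSucc)
      (fun i => hb i.castSucc)
    have ha' := ha (Fin.last k)
    have hb' := hb (Fin.last k)
    rw [Fin.val_last] at ha' hb'
    rw [wordLetters_succ, List.prod_append, List.prod_cons, List.prod_singleton, hν.mul_apply, h,
      hν.mul_apply, ha', hb']

/-- Pushing along a catenation `(I₁, J₁, …, I_k, J_k)`: there are right actions `σ` of `A`
supported on `⋃ Iᵢ` (preserving each `Iᵢ`) and `τ` of `B` supported on `⋃ Jᵢ`
(preserving each `Jᵢ`) such that the induced action `ν` of `A ∗ B` moves the point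
`1 = inf J₁` into `(2k+1−ε, 2k+1)` under `w = a₁b₁⋯a_k b_k`, where `2k+1 = sup J_k`. -/
theorem catenation_push_right
    {A B : Type*} [Group A] [Group B] [Countable A] [Countable B]
    (hA : IsRightOrderable A) (hB : IsRightOrderable B)
    {k : ℕ} (hk : 1 ≤ k) (a : Fin k → A) (b : Fin k → B)
    (ha : ∀ i, a i ≠ 1) (hb : ∀ i, b i ≠ 1) (ε : ℝ) (hε : 0 < ε) :
    ∃ (σ : A → (ℝ ≃o ℝ)) (τ : B → (ℝ ≃o ℝ)) (ν : Monoid.Coprod A B → (ℝ ≃o ℝ)),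
      (∀ g h : A, σ (g * h) = (σ g).trans (σ h)) ∧
      (∀ g h : B, τ (g * h) = (τ g).trans (τ h)) ∧
      (∀ α : A, ∀ i : Fin k, ⇑(σ α) '' catI i = catI i) ∧
      (∀ α : A, ∀ x : ℝ, x ∉ ⋃ i : Fin k, catI (i : ℕ) → σ α x = x) ∧
      (∀ β : B, ∀ i : Fin k, ⇑(τ β) '' catJ i = catJ i) ∧
      (∀ β : B, ∀ x : ℝ, x ∉ ⋃ i : Fin k, catJ (i : ℕ) → τ β x = x) ∧
      IsRightAction ν ∧
      (∀ α : A, ν (Monoid.Coprod.inl α) = σ α) ∧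
      (∀ β : B, ν (Monoid.Coprod.inr β) = τ β) ∧
      ν ((wordLetters a b).prod) 1 ∈
        Set.Ioo (2 * (k : ℝ) + 1 - ε) (2 * (k : ℝ) + 1) := by
  set δ : ℝ := min (ε / 2) (1 / 2)
  have hδ_pos : 0 < δ := lt_min (by linarith) (by norm_num)
  have hδ_eps : δ ≤ ε / 2 := min_le_left _ _
  have hδ_half : δ ≤ 1 / 2 := min_le_right _ _
  let s : ℕ → ℝ := fun i => if i = 0 then 1 else 2 * i + 1 - δ
  let t : ℕ → ℝ := fun i => 2 * i + 3 / 2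
  have s_succ : ∀ i : ℕ, s (i + 1) = 2 * i + 3 - δ := fun i => by
    simp only [s, Nat.add_eq_zero_iff, one_ne_zero, and_false, if_false]
    push_cast
    ring
  have s_bounds : ∀ i : ℕ, 2 * (i : ℝ) + 1 - δ ≤ s i ∧ s i ≤ 2 * i + 1 := fun i => by
    simp only [s]
    split_ifs with hi
    · subst hi
      constructor <;> push_cast <;> linarith
    · constructor <;> linarith
  obtain ⟨σ, hσ, hσI, hσfix, hσa⟩ := hA.exists_isRightAction_chain a ha 0 s t
    (fun i _ => by have := s_bounds i; simp only [t]; linarith)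
    (fun i _ => by have := s_bounds i; constructor <;> linarith)
    (fun i _ => by constructor <;> simp only [t] <;> linarith)
  obtain ⟨τ, hτ, hτJ, hτfix, hτb⟩ := hB.exists_isRightAction_chain b hb 1 t (fun i => s (i + 1))
    (fun i _ => by simp only [s_succ, t]; linarith)
    (fun i _ => by constructor <;> simp only [t] <;> linarith)
    (fun i _ => by constructor <;> simp only [s_succ] <;> linarith)
  obtain ⟨ν, hν, hνσ, hντ⟩ := exists_isRightAction_coprod hσ hτ
  have catI_eq : ∀ i : ℕ, catI i = Set.Ioo (2 * (i : ℝ) + 0) (2 * i + 0 + 2) := fun i => by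
    rw [catI, add_zero]
  have catJ_eq : ∀ i : ℕ, catJ i = Set.Ioo (2 * (i : ℝ) + 1) (2 * i + 1 + 2) := fun i => by
    rw [catJ, show 2 * (i : ℝ) + 1 + 2 = 2 * i + 3 by ring]
  simp only [catI_eq, catJ_eq]
  refine ⟨σ, τ, ν, hσ, hτ, hσI, hσfix, hτJ, hτfix, hν, hνσ, hντ, ?_⟩
  have hw := hν.wordLetters_prod_apply s t a b (fun i => by rw [hνσ, hσa])
    (fun i => by rw [hντ, hτb])
  have hs0 : s 0 = 1 := if_pos rfl
  have hsk : s k = 2 * k + 1 - δ := if_neg (by omega)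
  rw [← hs0, hw, hsk]
  constructor <;> linarith
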